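/- arXiv:cs/0101026 — 4 statements merged into one kernel-verified Lean document; each statement's English description precedes it below -/
import Mathlib

section
/- Let (C, S, N, f) be an automaton. Then f is commutative if and only if f is monotonic and has invariant histories. -/
namespace AsyncUpdating

variable {C S : Type*}

/-- `f` is a transition function for the neighborhood function `N`:
`f ξ x` depends only on the restriction of `ξ` to `N x`. -/
def IsTransition (N : C → Set C) (f : (C → S) → C → S) : Prop :=
  ∀ (ξ₁ ξ₂ : C → S) (x : C), (∀ y ∈ N x, ξ₁ y = ξ₂ y) → f ξ₁ x = f ξ₂ x

/-- The automaton is local: every neighborhood is finite. -/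
def IsLocal (N : C → Set C) : Prop := ∀ x, (N x).Finite

open Classical in
/-- `upd f ξ E` is the configuration `f(ξ, E)`: apply `f` at the sites of `E` only. -/
noncomputable def upd (f : (C → S) → C → S) (ξ : C → S) (E : Set C) : C → S :=
  fun x => if x ∈ E then f ξ x else ξ x

/-- The set `L(ξ)` of free sites. -/
def freeSet (f : (C → S) → C → S) (ξ : C → S) : Set C := {x | f ξ x ≠ ξ x}

/-- `η` is an asynchronous trajectory of `f`. -/
def IsAsyncTraj (f : (C → S) → C → S) (η : C → ℕ → S) : Prop :=
  ∀ x t, η x (t + 1) ≠ η x t → η x (t + 1) = f (fun y => η y t) x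

/-- `η` is a synchronous trajectory of `f`. -/
def IsSyncTraj (f : (C → S) → C → S) (η : C → ℕ → S) : Prop :=
  ∀ x t, η x (t + 1) = f (fun y => η y t) x

/-- The synchronous trajectory of `f` with initial configuration `ξ`. -/
def syncTraj (f : (C → S) → C → S) (ξ : C → S) : ℕ → C → S
  | 0 => ξ
  | t + 1 => f (syncTraj f ξ t)

/-- The update set `U(t, η)`. -/
def updSet (η : C → ℕ → S) (t : ℕ) : Set C := {x | η x (t + 1) ≠ η x t}

open Classical in
/-- The effective age `τ(x, t, η)`: the number of `s < t` with `x ∈ U(s, η)`. -/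
noncomputable def effAge (η : C → ℕ → S) (x : C) (t : ℕ) : ℕ :=
  ((Finset.range t).filter fun s => η x (s + 1) ≠ η x s).card

/-- `f` has invariant histories. -/
def InvariantHistories (f : (C → S) → C → S) : Prop :=
  ∀ ξ : C → S, ∃ ζ : C → ℕ → S, ∀ η : C → ℕ → S,
    IsAsyncTraj f η → (∀ x, η x 0 = ξ x) → ∀ x t, η x t = ζ x (effAge η x t)

/-- `f` is monotonic: `L(t,η) \ U(t,η) ⊆ L(t+1,η)` for every asynchronous trajectory. -/
def Monotonic (f : (C → S) → C → S) : Prop :=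
  ∀ η : C → ℕ → S, IsAsyncTraj f η → ∀ t,
    freeSet f (fun x => η x t) \ updSet η t ⊆ freeSet f (fun x => η x (t + 1))

/-- `f` is commutative. -/
def CommutativeRule (f : (C → S) → C → S) : Prop :=
  ∀ (ξ : C → S) (A B : Set C), Disjoint A B →
    A ⊆ freeSet f ξ → B ⊆ freeSet f ξ →
    upd f (upd f ξ A) B = upd f ξ (A ∪ B)

/-- `f` is locally commutative. -/
def LocallyCommutative (f : (C → S) → C → S) : Prop :=
  ∀ (ξ : C → S) (x y : C), x ≠ y → x ∈ freeSet f ξ → y ∈ freeSet f ξ →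
    upd f (upd f ξ {x}) {y} = upd f ξ {x, y}

/-- `η₁` dominates `η₀` (they are assumed to have the same initial configuration). -/
def Dominates (η₁ η₀ : C → ℕ → S) : Prop :=
  (∀ x t, effAge η₀ x t ≤ effAge η₁ x t) ∧
  (∀ x t₀ t₁, effAge η₀ x t₀ = effAge η₁ x t₁ → η₀ x t₀ = η₁ x t₁)

/-! ### Update sets and effective ages -/

lemma upd_of_mem {f : (C → S) → C → S} {ξ : C → S} {E : Set C} {x : C} (h : x ∈ E) :
    upd f ξ E x = f ξ x := if_pos h

lemma upd_of_notMem {f : (C → S) → C → S} {ξ : C → S} {E : Set C} {x : C} (h : x ∉ E) :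
    upd f ξ E x = ξ x := if_neg h

lemma IsAsyncTraj.updSet_subset_freeSet {f : (C → S) → C → S} {η : C → ℕ → S}
    (hη : IsAsyncTraj f η) (t : ℕ) : updSet η t ⊆ freeSet f (fun y => η y t) := by
  intro x hx
  rw [freeSet, Set.mem_ofPred_eq, ← hη x t hx]
  exact hx

lemma IsAsyncTraj.succ_eq_upd {f : (C → S) → C → S} {η : C → ℕ → S}
    (hη : IsAsyncTraj f η) (t : ℕ) :
    (fun y => η y (t + 1)) = upd f (fun y => η y t) (updSet η t) := by
  funext x
  by_cases h : x ∈ updSet η t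
  · rw [upd_of_mem h]
    exact hη x t h
  · rw [upd_of_notMem h]
    exact not_not.mp h

lemma isAsyncTraj_of_succ_eq_upd {f : (C → S) → C → S} {η : C → ℕ → S} (E : ℕ → Set C)
    (h : ∀ t, (fun y => η y (t + 1)) = upd f (fun y => η y t) (E t)) : IsAsyncTraj f η := by
  intro x t hx
  have ht : η x (t + 1) = _ := congrFun (h t) x
  by_cases hE : x ∈ E t
  · rwa [upd_of_mem hE] at ht
  · rw [upd_of_notMem hE] at ht
    exact absurd ht hx

lemma effAge_zero (η : C → ℕ → S) (x : C) : effAge η x 0 = 0 := by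
  simp [effAge]

lemma effAge_succ_of_mem {η : C → ℕ → S} {x : C} {t : ℕ} (h : x ∈ updSet η t) :
    effAge η x (t + 1) = effAge η x t + 1 := by
  have h' : η x (t + 1) ≠ η x t := h
  simp [effAge, Finset.range_add_one, Finset.filter_insert, h']

lemma effAge_succ_of_notMem {η : C → ℕ → S} {x : C} {t : ℕ} (h : x ∉ updSet η t) :
    effAge η x (t + 1) = effAge η x t := by
  have h' : η x (t + 1) = η x t := not_not.mp h
  simp [effAge, Finset.range_add_one, Finset.filter_insert, h']

lemma effAge_shift_of_mem {η : C → ℕ → S} {x : C} (h : x ∈ updSet η 0) (t : ℕ) :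
    effAge η x (t + 1) = effAge (fun y s => η y (s + 1)) x t + 1 := by
  induction t with
  | zero => rw [effAge_succ_of_mem h, effAge_zero, effAge_zero]
  | succ t ih =>
    by_cases ht : x ∈ updSet η (t + 1)
    · rw [effAge_succ_of_mem ht, ih,
        effAge_succ_of_mem (η := fun y s => η y (s + 1)) (t := t) ht]
    · rw [effAge_succ_of_notMem ht, ih,
        effAge_succ_of_notMem (η := fun y s => η y (s + 1)) (t := t) ht]

lemma effAge_shift_of_notMem {η : C → ℕ → S} {x : C} (h : x ∉ updSet η 0) (t : ℕ) :
    effAge η x (t + 1) = effAge (fun y s => η y (s + 1)) x t := by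
  induction t with
  | zero => rw [effAge_succ_of_notMem h, effAge_zero, effAge_zero]
  | succ t ih =>
    by_cases ht : x ∈ updSet η (t + 1)
    · rw [effAge_succ_of_mem ht, ih,
        effAge_succ_of_mem (η := fun y s => η y (s + 1)) (t := t) ht]
    · rw [effAge_succ_of_notMem ht, ih,
        effAge_succ_of_notMem (η := fun y s => η y (s + 1)) (t := t) ht]

lemma eq_initial_of_effAge_eq_zero {η : C → ℕ → S} {x : C} {t : ℕ}
    (h : effAge η x t = 0) : η x t = η x 0 := by
  induction t with
  | zero => rfl
  | succ t ih =>
    by_cases ht : x ∈ updSet η t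
    · rw [effAge_succ_of_mem ht] at h
      omega
    · rw [effAge_succ_of_notMem ht] at h
      exact (not_not.mp ht).trans (ih h)

/-! ### Commutative rules -/

lemma CommutativeRule.apply_upd_of_notMem {f : (C → S) → C → S} (hc : CommutativeRule f)
    {ξ : C → S} {A : Set C} {x : C} (hA : A ⊆ freeSet f ξ) (hx : x ∈ freeSet f ξ)
    (hxA : x ∉ A) : f (upd f ξ A) x = f ξ x := by
  have h := congrFun (hc ξ A {x} (Set.disjoint_singleton_right.mpr hxA) hA
    (Set.singleton_subset_iff.mpr hx)) x
  rwa [upd_of_mem (Set.mem_singleton x),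
    upd_of_mem (Set.mem_union_right A (Set.mem_singleton x))] at h

lemma CommutativeRule.monotonic {f : (C → S) → C → S} (hc : CommutativeRule f) :
    Monotonic f := by
  rintro η hη t x ⟨hx, hxU⟩
  rw [freeSet, Set.mem_ofPred_eq, hη.succ_eq_upd t,
    hc.apply_upd_of_notMem (hη.updSet_subset_freeSet t) hx hxU]
  exact (not_not.mp hxU : η x (t + 1) = η x t) ▸ hx

/-- The sites of `A` that `η` has not updated before time `t`. -/
def pending (η : C → ℕ → S) (A : Set C) (t : ℕ) : Set C := {x ∈ A | effAge η x t = 0}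

/-- The trajectory `η` with the updates at the sites of `A` brought forward to time `0`. -/
noncomputable def advance (f : (C → S) → C → S) (η : C → ℕ → S) (A : Set C) : C → ℕ → S :=
  fun x t => upd f (fun y => η y t) (pending η A t) x

lemma pending_zero (η : C → ℕ → S) (A : Set C) : pending η A 0 = A := by
  simp [pending, effAge_zero]

lemma pending_succ (η : C → ℕ → S) (A : Set C) (t : ℕ) :
    pending η A (t + 1) = pending η A t \ updSet η t := by
  ext x
  by_cases h : x ∈ updSet η t
  · simp [pending, effAge_succ_of_mem h, h]
  · simp [pending, effAge_succ_of_notMem h, h]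

section Advance

variable {f : (C → S) → C → S} {η : C → ℕ → S} {A : Set C}

lemma Monotonic.pending_subset_freeSet (hm : Monotonic f) (hη : IsAsyncTraj f η)
    (hA : A ⊆ freeSet f (fun y => η y 0)) (t : ℕ) :
    pending η A t ⊆ freeSet f (fun y => η y t) := by
  induction t with
  | zero => rwa [pending_zero]
  | succ t ih =>
    rw [pending_succ]
    exact (Set.sdiff_subset_sdiff_left ih).trans (hm η hη t)

lemma CommutativeRule.advance_succ_eq_union (hc : CommutativeRule f) (hη : IsAsyncTraj f η)
    (hA : A ⊆ freeSet f (fun y => η y 0)) (t : ℕ) :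
    (fun y => advance f η A y (t + 1)) =
      upd f (fun y => η y t) (updSet η t ∪ pending η A t) := by
  have hp := hc.monotonic.pending_subset_freeSet hη hA t
  change upd f (fun y => η y (t + 1)) (pending η A (t + 1)) = _
  rw [pending_succ, hη.succ_eq_upd t, hc _ _ _ Set.disjoint_sdiff_right
    (hη.updSet_subset_freeSet t) (Set.sdiff_subset.trans hp), Set.union_sdiff_self]

lemma CommutativeRule.advance_succ (hc : CommutativeRule f) (hη : IsAsyncTraj f η)
    (hA : A ⊆ freeSet f (fun y => η y 0)) (t : ℕ) :
    (fun y => advance f η A y (t + 1)) =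
      upd f (fun y => advance f η A y t) (updSet η t \ pending η A t) := by
  have hp := hc.monotonic.pending_subset_freeSet hη hA t
  rw [hc.advance_succ_eq_union hη hA, Set.union_comm, ← Set.union_sdiff_self]
  exact (hc _ _ _ Set.disjoint_sdiff_right hp
    (Set.sdiff_subset.trans (hη.updSet_subset_freeSet t))).symm

lemma CommutativeRule.isAsyncTraj_advance (hc : CommutativeRule f) (hη : IsAsyncTraj f η)
    (hA : A ⊆ freeSet f (fun y => η y 0)) : IsAsyncTraj f (advance f η A) :=
  isAsyncTraj_of_succ_eq_upd _ (hc.advance_succ hη hA)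

lemma CommutativeRule.updSet_advance (hc : CommutativeRule f) (hη : IsAsyncTraj f η)
    (hA : A ⊆ freeSet f (fun y => η y 0)) (t : ℕ) :
    updSet (advance f η A) t = updSet η t \ pending η A t := by
  ext x
  have h : advance f η A x (t + 1) = _ := congrFun (hc.advance_succ_eq_union hη hA t) x
  rw [updSet, Set.mem_ofPred_eq, h, advance]
  by_cases hx : x ∈ pending η A t
  · simp [upd_of_mem hx, upd_of_mem (Set.mem_union_right (updSet η t) hx), hx]
  · by_cases hU : x ∈ updSet η t
    · rw [upd_of_notMem hx, upd_of_mem (Set.mem_union_left _ hU)]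
      exact iff_of_true (hη.updSet_subset_freeSet t hU) ⟨hU, hx⟩
    · rw [upd_of_notMem hx, upd_of_notMem (by simp [hx, hU])]
      simp [hU]

lemma CommutativeRule.effAge_advance_of_mem (hc : CommutativeRule f) (hη : IsAsyncTraj f η)
    (hA : A ⊆ freeSet f (fun y => η y 0)) {x : C} (hx : x ∈ A) (t : ℕ) :
    effAge (advance f η A) x t = effAge η x t - 1 := by
  induction t with
  | zero => simp [effAge_zero]
  | succ t ih =>
    have hU : x ∈ updSet (advance f η A) t ↔ x ∈ updSet η t ∧ effAge η x t ≠ 0 := by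
      simp [hc.updSet_advance hη hA t, pending, hx]
    by_cases h : x ∈ updSet η t
    · rw [effAge_succ_of_mem h]
      by_cases h0 : effAge η x t = 0
      · rw [effAge_succ_of_notMem (by simp [hU, h0]), ih]
        omega
      · rw [effAge_succ_of_mem (hU.mpr ⟨h, h0⟩), ih]
        omega
    · rw [effAge_succ_of_notMem h, effAge_succ_of_notMem (by simp [hU, h]), ih]

lemma CommutativeRule.effAge_advance_of_notMem (hc : CommutativeRule f) (hη : IsAsyncTraj f η)
    (hA : A ⊆ freeSet f (fun y => η y 0)) {x : C} (hx : x ∉ A) (t : ℕ) :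
    effAge (advance f η A) x t = effAge η x t := by
  induction t with
  | zero => simp [effAge_zero]
  | succ t ih =>
    have hU : x ∈ updSet (advance f η A) t ↔ x ∈ updSet η t := by
      simp [hc.updSet_advance hη hA t, pending, hx]
    by_cases h : x ∈ updSet η t
    · rw [effAge_succ_of_mem h, effAge_succ_of_mem (hU.mpr h), ih]
    · rw [effAge_succ_of_notMem h, effAge_succ_of_notMem (mt hU.mp h), ih]

end Advance

lemma CommutativeRule.eq_of_effAge_eq {f : (C → S) → C → S} (hc : CommutativeRule f)
    {η η' : C → ℕ → S} (hη : IsAsyncTraj f η) (hη' : IsAsyncTraj f η')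
    (h0 : ∀ y, η y 0 = η' y 0) {x : C} {t t' : ℕ}
    (h : effAge η x t = effAge η' x t') : η x t = η' x t' := by
  induction t generalizing η η' with
  | zero =>
    rw [effAge_zero] at h
    rw [h0, eq_initial_of_effAge_eq_zero h.symm]
  | succ t ih =>
    have hstart : (fun y => η y 0) = fun y => η' y 0 := funext h0
    have hA : updSet η 0 ⊆ freeSet f (fun y => η' y 0) :=
      hstart ▸ hη.updSet_subset_freeSet 0
    have hinit (y : C) : η y (0 + 1) = advance f η' (updSet η 0) y 0 := by
      rw [advance, pending_zero, ← hstart]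
      exact congrFun (hη.succ_eq_upd 0) y
    have hx : x ∉ pending η' (updSet η 0) t' := by
      rintro ⟨hxA, hx0⟩
      rw [effAge_shift_of_mem hxA] at h
      omega
    have hval : advance f η' (updSet η 0) x t' = η' x t' := upd_of_notMem hx
    rw [← hval]
    refine ih (η := fun y s => η y (s + 1)) (fun y s => hη y (s + 1))
      (hc.isAsyncTraj_advance hη' hA) hinit ?_
    by_cases hxA : x ∈ updSet η 0
    · rw [effAge_shift_of_mem hxA] at h
      rw [hc.effAge_advance_of_mem hη' hA hxA]
      omega
    · rw [effAge_shift_of_notMem hxA] at h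
      rw [hc.effAge_advance_of_notMem hη' hA hxA, h]

lemma CommutativeRule.invariantHistories {f : (C → S) → C → S} (hc : CommutativeRule f) :
    InvariantHistories f := by
  classical
  intro ξ
  let P (x : C) (k : ℕ) (s : S) : Prop :=
    ∃ η t, IsAsyncTraj f η ∧ (∀ y, η y 0 = ξ y) ∧ effAge η x t = k ∧ η x t = s
  refine ⟨fun x k => if h : ∃ s, P x k s then h.choose else ξ x, fun η hη h0 x t => ?_⟩
  have hex : ∃ s, P x (effAge η x t) s := ⟨η x t, η, t, hη, h0, rfl, rfl⟩
  obtain ⟨η', t', hη', h0', hage, hval⟩ := hex.choose_spec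
  refine Eq.trans ?_ (dif_pos hex).symm
  rw [← hval]
  exact hc.eq_of_effAge_eq hη hη' (fun y => (h0 y).trans (h0' y).symm) hage.symm

/-! ### Trajectories that update prescribed sets -/

/-- The trajectory from `ξ` that updates `A`, then `B`, and is constant afterwards. -/
noncomputable def twoStepTraj (f : (C → S) → C → S) (ξ : C → S) (A B : Set C) : C → ℕ → S
  | x, 0 => ξ x
  | x, 1 => upd f ξ A x
  | x, _ + 2 => upd f (upd f ξ A) B x

lemma isAsyncTraj_twoStepTraj (f : (C → S) → C → S) (ξ : C → S) (A B : Set C) :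
    IsAsyncTraj f (twoStepTraj f ξ A B) := by
  refine isAsyncTraj_of_succ_eq_upd (fun | 0 => A | 1 => B | _ + 2 => ∅) fun t => ?_
  match t with
  | 0 => rfl
  | 1 => rfl
  | t + 2 =>
    funext x
    rw [upd_of_notMem (Set.notMem_empty x)]
    rfl

lemma commutativeRule_of_monotonic_of_invariantHistories {f : (C → S) → C → S}
    (hm : Monotonic f) (hi : InvariantHistories f) : CommutativeRule f := by
  intro ξ A B hAB hA hB
  funext x
  by_cases hxB : x ∈ B
  · have hxA : x ∉ A := fun h => Set.disjoint_left.mp hAB h hxB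
    obtain ⟨ζ, hζ⟩ := hi ξ
    have hη := isAsyncTraj_twoStepTraj f ξ A B
    have hθ := isAsyncTraj_twoStepTraj f ξ (A ∪ B) ∅
    have hx0 : x ∉ updSet (twoStepTraj f ξ A B) 0 := not_not.mpr (upd_of_notMem hxA)
    have hx1 : x ∈ updSet (twoStepTraj f ξ A B) 1 := by
      have hfree := hm _ hη 0 ⟨hB hxB, hx0⟩
      change upd f (upd f ξ A) B x ≠ upd f ξ A x
      rw [upd_of_mem hxB]
      exact hfree
    have hy0 : x ∈ updSet (twoStepTraj f ξ (A ∪ B) ∅) 0 := by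
      change upd f ξ (A ∪ B) x ≠ ξ x
      rw [upd_of_mem (Set.mem_union_right A hxB)]
      exact hB hxB
    have h1 := hζ _ hη (fun _ => rfl) x 2
    have h2 := hζ _ hθ (fun _ => rfl) x 1
    rw [effAge_succ_of_mem hx1, effAge_succ_of_notMem hx0, effAge_zero] at h1
    rw [effAge_succ_of_mem hy0, effAge_zero] at h2
    exact h1.trans h2.symm
  · rw [upd_of_notMem hxB]
    by_cases hxA : x ∈ A
    · rw [upd_of_mem hxA, upd_of_mem (Set.mem_union_left B hxA)]
    · rw [upd_of_notMem hxA, upd_of_notMem (by simp [hxA, hxB])]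

/-- Let (C, S, N, f) be an automaton. Then f is commutative if and only if
f is monotonic and has invariant histories. -/
theorem commutative_iff_monotonic_and_invariantHistories
    {C S : Type*} (N : C → Set C) (f : (C → S) → C → S)
    (hf : IsTransition N f) :
    CommutativeRule f ↔ (Monotonic f ∧ InvariantHistories f) :=
  ⟨fun hc => ⟨hc.monotonic, hc.invariantHistories⟩,
    fun h => commutativeRule_of_monotonic_of_invariantHistories h.1 h.2⟩

end AsyncUpdating
end

section
/- Let (C, S, N, f) be an automaton. If f is commutative then f is monotonic. -/
namespace AsyncUpdating

variable {C S : Type*}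

/-- Let (C, S, N, f) be an automaton. If f is commutative then f is
monotonic. -/
theorem monotonic_of_commutative
    {C S : Type*} (N : C → Set C) (f : (C → S) → C → S)
    (hf : IsTransition N f) (hc : CommutativeRule f) :
    Monotonic f := by
  intro η hη t x hx
  obtain ⟨hfree, hx_upd⟩ := hx
  have hnext : upd f (fun y => η y t) (updSet η t) = fun y => η y (t + 1) := by
    funext y
    by_cases hy : y ∈ updSet η t
    · simpa [upd, hy] using (hη y t hy).symm
    · simpa [upd, hy, eq_comm] using not_not.mp hy
  have hsub : updSet η t ⊆ freeSet f (fun y => η y t) := by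
    intro y hy
    change f (fun z => η z t) y ≠ η y t
    rw [← hη y t hy]
    exact hy
  have hcomm := congrFun (hc _ (updSet η t) {x} (Set.disjoint_singleton_right.mpr hx_upd) hsub
    (Set.singleton_subset_iff.mpr hfree)) x
  rw [hnext] at hcomm
  have hval : f (fun y => η y (t + 1)) x = f (fun y => η y t) x := by
    simpa [upd] using hcomm
  have hsame : η x (t + 1) = η x t := not_not.mp hx_upd
  change f (fun y => η y (t + 1)) x ≠ η x (t + 1)
  rw [hval, hsame]
  exact hfree

end AsyncUpdating
end

section
/- Let (C, S₁, N, f₁) be a local automaton where x ∈ N(x) for all x and N is symmetric (y ∈ N(x) iff x ∈ N(y)). Then the transition function f₂ of the marching-soldiers automaton over (C, S₁, N, f₁) is locally commutative. -/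
namespace AsyncUpdating

variable {C S : Type*}

/-- `b amod m`: the integer `x` with `x ≡ b (mod m)` and `-m/2 < x ≤ m/2`. -/
def amod (b m : ℤ) : ℤ := if b % m ≤ m / 2 then b % m else b % m - m

open Classical in
/-- The transition function of the marching-soldiers automaton over `(C, S, N, f₁)`,
with states `(Cur, Prev, Age) : S × S × Fin 3`. -/
noncomputable def march {C S : Type*} (N : C → Set C) (f₁ : (C → S) → C → S)
    (ξ : C → S × S × Fin 3) (x : C) : S × S × Fin 3 :=
  if ∃ y ∈ N x, amod (((ξ y).2.2.val : ℤ) - ((ξ x).2.2.val : ℤ)) 3 < 0 then ξ x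
  else (f₁ (fun y => if (ξ y).2.2 = (ξ x).2.2 then (ξ y).1 else (ξ y).2.1) x,
        (ξ x).1, (ξ x).2.2 + 1)

theorem eq_of_amod_three_nonneg (a b : Fin 3)
    (hab : ¬ amod ((a.val : ℤ) - (b.val : ℤ)) 3 < 0)
    (hba : ¬ amod ((b.val : ℤ) - (a.val : ℤ)) 3 < 0) : a = b := by
  revert a b
  decide

theorem amod_three_succ_nonneg (a : Fin 3) :
    ¬ amod (((a + 1 : Fin 3).val : ℤ) - (a.val : ℤ)) 3 < 0 := by
  revert a
  decide

theorem not_exists_younger_of_mem_freeSet {N : C → Set C} {f₁ : (C → S) → C → S}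
    {ξ : C → S × S × Fin 3} {x : C} (hx : x ∈ freeSet (march N f₁) ξ) :
    ¬ ∃ y ∈ N x, amod (((ξ y).2.2.val : ℤ) - ((ξ x).2.2.val : ℤ)) 3 < 0 :=
  fun h => hx (by simp only [march, if_pos h])

theorem march_of_mem_freeSet {N : C → Set C} {f₁ : (C → S) → C → S}
    {ξ : C → S × S × Fin 3} {x : C} (hx : x ∈ freeSet (march N f₁) ξ) :
    march N f₁ ξ x =
      (f₁ (fun y => if (ξ y).2.2 = (ξ x).2.2 then (ξ y).1 else (ξ y).2.1) x,
        (ξ x).1, (ξ x).2.2 + 1) := by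
  simp only [march, if_neg (not_exists_younger_of_mem_freeSet hx)]

/-- Neighboring free sites of the marching-soldiers automaton have the same age. -/
theorem age_eq_of_mem_freeSet {N : C → Set C} {f₁ : (C → S) → C → S}
    {ξ : C → S × S × Fin 3} {x y : C} (hxy : x ∈ N y) (hyx : y ∈ N x)
    (hx : x ∈ freeSet (march N f₁) ξ) (hy : y ∈ freeSet (march N f₁) ξ) :
    (ξ x).2.2 = (ξ y).2.2 :=
  eq_of_amod_three_nonneg _ _
    (fun h => not_exists_younger_of_mem_freeSet hy ⟨x, hxy, h⟩)
    (fun h => not_exists_younger_of_mem_freeSet hx ⟨y, hyx, h⟩)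

/-- Updating one free site does not change the effect of the rule at another one. -/
theorem march_upd_singleton {N : C → Set C} {f₁ : (C → S) → C → S}
    (hf : IsTransition N f₁) (hsym : ∀ x y, y ∈ N x ↔ x ∈ N y)
    {ξ : C → S × S × Fin 3} {x y : C} (hxy : x ≠ y)
    (hx : x ∈ freeSet (march N f₁) ξ) (hy : y ∈ freeSet (march N f₁) ξ) :
    march N f₁ (upd (march N f₁) ξ {x}) y = march N f₁ ξ y := by
  have hne : ∀ z, z ≠ x → upd (march N f₁) ξ {x} z = ξ z := fun z hz => by simp [upd, hz]
  have hxx : upd (march N f₁) ξ {x} x = march N f₁ ξ x := by simp [upd]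
  rw [march_of_mem_freeSet hx] at hxx
  have hage (h : x ∈ N y) := age_eq_of_mem_freeSet h ((hsym x y).2 h) hx hy
  have hold : ¬ ∃ z ∈ N y, amod (((upd (march N f₁) ξ {x} z).2.2.val : ℤ) -
      ((upd (march N f₁) ξ {x} y).2.2.val : ℤ)) 3 < 0 := by
    rintro ⟨z, hz, hlt⟩
    rw [hne y hxy.symm] at hlt
    by_cases hzx : z = x
    · subst hzx
      rw [hxx, hage hz] at hlt
      exact amod_three_succ_nonneg _ hlt
    · rw [hne z hzx] at hlt
      exact not_exists_younger_of_mem_freeSet hy ⟨z, hz, hlt⟩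
  rw [march_of_mem_freeSet hy, march, if_neg hold, hne y hxy.symm]
  congr 1
  refine hf _ _ y fun z hz => ?_
  by_cases hzx : z = x
  · subst hzx
    simp [hxx, hage hz]
  · simp only [hne z hzx]

/-- Let (C, S₁, N, f₁) be a local automaton where x ∈ N(x) for all x and
N is symmetric. Then the transition function f₂ of the marching-soldiers automaton over
(C, S₁, N, f₁) is locally commutative. -/
theorem march_locallyCommutative
    {C S₁ : Type*} (N : C → Set C) (f₁ : (C → S₁) → C → S₁)
    (hf : IsTransition N f₁) (hloc : IsLocal N)
    (hrefl : ∀ x, x ∈ N x) (hsym : ∀ x y, y ∈ N x ↔ x ∈ N y) :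
    LocallyCommutative (march N f₁) := by
  intro ξ x y hxy hx hy
  have h := march_upd_singleton hf hsym hxy hx hy
  funext z
  by_cases hzy : z = y
  · subst hzy
    simpa [upd] using h
  · by_cases hzx : z = x <;> simp [upd, hzy, hzx, hxy]

end AsyncUpdating
end

section
/- Let (C, S₁, N, f₁) be a local automaton with x ∈ N(x) for all x, let s₀ ∈ S₁, and let f₂ be the transition function of the marching-soldiers automaton over (C, S₁, N, f₁). Let ξ₁ be a configuration of f₁, let η₁ be the synchronous trajectory of f₁ with initial configuration ξ₁, and let η₂ be the synchronous trajectory of f₂ with initial configuration ξ₂(x) = (ξ₁(x), s₀, 0). Then for every x and every t ≥ 1, η₂(x,t) = (η₁(x,t), η₁(x,t−1), t mod 3). -/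
namespace AsyncUpdating

variable {C S : Type*}

/-- If all ages agree, one step of the marching-soldiers automaton updates every site. -/
theorem march_of_age_eq {C S : Type*} (N : C → Set C) (f₁ : (C → S) → C → S)
    (ξ : C → S × S × Fin 3) (a : Fin 3) (h : ∀ y, (ξ y).2.2 = a) :
    march N f₁ ξ = fun x => (f₁ (fun y => (ξ y).1) x, (ξ x).1, a + 1) := by
  funext x
  simp [march, h, amod]

theorem syncTraj_march_succ {C S : Type*} (N : C → Set C) (f₁ : (C → S) → C → S)
    (s₀ : S) (ξ₁ : C → S) (t : ℕ) :
    syncTraj (march N f₁) (fun x => (ξ₁ x, s₀, (0 : Fin 3))) (t + 1) =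
      fun x => (syncTraj f₁ ξ₁ (t + 1) x, syncTraj f₁ ξ₁ t x,
        (⟨(t + 1) % 3, by omega⟩ : Fin 3)) := by
  induction t with
  | zero => exact march_of_age_eq N f₁ _ 0 fun _ => rfl
  | succ t ih =>
    rw [syncTraj, ih, march_of_age_eq N f₁ _ ⟨(t + 1) % 3, by omega⟩ fun _ => rfl]
    funext x
    refine Prod.ext rfl (Prod.ext rfl (Fin.ext ?_))
    simp [Fin.val_add]

/-- Let (C, S₁, N, f₁) be a local automaton with x ∈ N(x) for all x, let
s₀ ∈ S₁, and let f₂ be the transition function of the marching-soldiers automaton over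
(C, S₁, N, f₁). Let η₁ be the synchronous trajectory of f₁ with initial configuration
ξ₁, and η₂ the synchronous trajectory of f₂ with initial configuration
ξ₂(x) = (ξ₁(x), s₀, 0). Then for every x and t ≥ 1,
η₂(x,t) = (η₁(x,t), η₁(x,t−1), t mod 3). -/
theorem march_syncTraj_simulates
    {C S₁ : Type*} (N : C → Set C) (f₁ : (C → S₁) → C → S₁)
    (hf : IsTransition N f₁) (hloc : IsLocal N) (hrefl : ∀ x, x ∈ N x)
    (s₀ : S₁) (ξ₁ : C → S₁) :
    ∀ (x : C) (t : ℕ), 1 ≤ t →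
      syncTraj (march N f₁) (fun x => (ξ₁ x, s₀, (0 : Fin 3))) t x =
        (syncTraj f₁ ξ₁ t x, syncTraj f₁ ξ₁ (t - 1) x, (⟨t % 3, by omega⟩ : Fin 3)) := by
  intro x t ht
  obtain ⟨t, rfl⟩ := Nat.exists_eq_add_of_le' ht
  exact congrFun (syncTraj_march_succ N f₁ s₀ ξ₁ t) x

end AsyncUpdating
end
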